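/- Let H be a Hopf algebra acting partially (symmetrically) on a unital algebra A, and let A#H denote the partial smash product. Then the map π₀ : H → A#H given by π₀(h) = 1_A # h is a partial representation of H. -/

import Mathlib

open TensorProduct BigOperators HopfAlgebra

variable {k : Type} [CommRing k]
variable {H : Type} [Ring H] [HopfAlgebra k H]
variable {A : Type} [Ring A] [Algebra k A]

/-- The map `H ⊗ A → A ⊗ H`, `h ⊗ b ↦ ∑ (h₍₁₎·b) ⊗ h₍₂₎`, for an action `act`. -/
noncomputable def smashHalf (act : H →ₗ[k] Module.End k A) : H ⊗[k] A →ₗ[k] A ⊗[k] H :=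
  (TensorProduct.map (TensorProduct.lift (act : H →ₗ[k] A →ₗ[k] A)) LinearMap.id) ∘ₗ
    (TensorProduct.assoc k H A H).symm.toLinearMap ∘ₗ
    (TensorProduct.map LinearMap.id (TensorProduct.comm k H A).toLinearMap) ∘ₗ
    (TensorProduct.assoc k H H A).toLinearMap ∘ₗ
    (TensorProduct.map (Coalgebra.comul (R := k)) LinearMap.id)

/-- The smash multiplication on `A ⊗ H`: `(a ⊗ h)(b ⊗ x) = ∑ a(h₍₁₎·b) ⊗ h₍₂₎x`. -/
noncomputable def smashMul (act : H →ₗ[k] Module.End k A) :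
    (A ⊗[k] H) →ₗ[k] (A ⊗[k] H) →ₗ[k] (A ⊗[k] H) :=
  TensorProduct.curry <|
    (TensorProduct.map (LinearMap.mul' k A) LinearMap.id) ∘ₗ
    (TensorProduct.assoc k A A H).symm.toLinearMap ∘ₗ
    (TensorProduct.map LinearMap.id
      ((TensorProduct.map LinearMap.id (LinearMap.mul' k H)) ∘ₗ
        (TensorProduct.assoc k A H H).toLinearMap ∘ₗ
        (TensorProduct.map (smashHalf act) LinearMap.id) ∘ₗ
        (TensorProduct.assoc k H A H).symm.toLinearMap)) ∘ₗ
    (TensorProduct.assoc k A H (A ⊗[k] H)).toLinearMap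

/-- The element `a # h := (a ⊗ h)(1_A ⊗ 1_H)` of the partial smash product. -/
noncomputable def sharp (act : H →ₗ[k] Module.End k A) (a : A) (h : H) : A ⊗[k] H :=
  smashMul act (a ⊗ₜ[k] h) ((1 : A) ⊗ₜ[k] (1 : H))

open Coalgebra in
noncomputable def sw (k : Type) [CommRing k] {H : Type} [Ring H] [HopfAlgebra k H]
    {M : Type} [AddCommGroup M] (h : H) (f : H → H → M) : M :=
  ∑ i ∈ (ℛ k h).index, f ((ℛ k h).left i) ((ℛ k h).right i)

structure Bil (k : Type) [CommRing k] {H : Type} [Ring H] [HopfAlgebra k H]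
    {M : Type} [AddCommGroup M] [Module k M] (f : H → H → M) : Prop where
  l : ∀ b, IsLinearMap k (fun a => f a b)
  r : ∀ a, IsLinearMap k (fun b => f a b)

structure Tri (k : Type) [CommRing k] {H : Type} [Ring H] [HopfAlgebra k H]
    {M : Type} [AddCommGroup M] [Module k M] (f : H → H → H → M) : Prop where
  l : ∀ b c, IsLinearMap k (fun a => f a b c)
  m : ∀ a c, IsLinearMap k (fun b => f a b c)
  r : ∀ a b, IsLinearMap k (fun c => f a b c)

set_option linter.unusedSectionVars false
set_option linter.unusedSimpArgs false

section swlemmas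
variable {M : Type} [AddCommGroup M] [Module k M]

noncomputable def Bil.lin {f : H → H → M} (hf : Bil k f) : H →ₗ[k] H →ₗ[k] M :=
  LinearMap.mk₂ k f (fun a b c => (hf.l c).map_add a b) (fun r a c => (hf.l c).map_smul r a)
    (fun a b c => (hf.r a).map_add b c) (fun r a c => (hf.r a).map_smul r c)

lemma sw_lift {f : H → H → M} (hf : Bil k f) (h : H) :
    sw k h f = TensorProduct.lift hf.lin (Coalgebra.comul (R := k) h) := by
  rw [← (Coalgebra.Repr.arbitrary k h).eq]
  simp [sw, Bil.lin]

lemma sw_eq {f : H → H → M} (hf : Bil k f) {h : H} {ι : Type} {s : Finset ι} {a b : ι → H}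
    (e : Coalgebra.comul (R := k) h = ∑ i ∈ s, a i ⊗ₜ[k] b i) :
    ∑ i ∈ s, f (a i) (b i) = sw k h f := by
  rw [sw_lift hf, e]; simp [Bil.lin]

lemma sw_congr {h : H} {f g : H → H → M} (e : ∀ a b, f a b = g a b) : sw k h f = sw k h g := by
  simp [sw, e]

lemma sw_comm {h x : H} {f : H → H → H → H → M} :
    sw k h (fun a b => sw k x (f a b)) = sw k x (fun c d => sw k h (fun a b => f a b c d)) := by
  unfold sw; rw [Finset.sum_comm]

lemma lin_sw1 {f : H → H → M} (hf : Bil k f) : IsLinearMap k (fun x => sw k x f) := by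
  simp only [sw_lift hf]
  exact (TensorProduct.lift hf.lin ∘ₗ Coalgebra.comul).isLinear

lemma lin_sw2 {N : Type} [AddCommGroup N] [Module k N]
    {h : H} {f : N → H → H → M} (hf : ∀ a b, IsLinearMap k (fun x => f x a b)) :
    IsLinearMap k (fun x => sw k h (f x)) :=
  ⟨fun x y => by simp [sw, (hf _ _).map_add, Finset.sum_add_distrib],
   fun r x => by simp [sw, (hf _ _).map_smul, Finset.smul_sum]⟩

lemma map_sw {N : Type} [AddCommGroup N] [Module k N] (g : M →ₗ[k] N) (h : H) (f : H → H → M) :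
    g (sw k h f) = sw k h (fun a b => g (f a b)) := by simp [sw]

lemma sw_coassoc {f : H → H → H → M} (hf : Tri k f) (h : H) :
    sw k h (fun a b => sw k a (fun a1 a2 => f a1 a2 b)) =
    sw k h (fun a b => sw k b (fun b1 b2 => f a b1 b2)) := by
  have hB : ∀ a, Bil k (f a) := fun a => ⟨fun c => hf.m a c, fun c => hf.r a c⟩
  let F : H →ₗ[k] (H ⊗[k] H) →ₗ[k] M := IsLinearMap.mk' (fun a => TensorProduct.lift (hB a).lin)
    ⟨fun a b => by ext x y; simpa [Bil.lin] using (hf.l x y).map_add a b,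
     fun r a => by ext x y; simpa [Bil.lin] using (hf.l x y).map_smul r a⟩
  have := congrArg (TensorProduct.lift F) (Coalgebra.sum_tmul_tmul_eq (Coalgebra.Repr.arbitrary k h)
    (fun i => Coalgebra.Repr.arbitrary k _) (fun i => Coalgebra.Repr.arbitrary k _))
  simpa [F, Bil.lin, sw] using this

lemma sw_counit_l {f : H → M} (hf : IsLinearMap k f) (h : H) :
    sw k h (fun a b => Coalgebra.counit (R := k) a • f b) = f h := by
  conv_rhs => rw [← Coalgebra.sum_counit_smul (Coalgebra.Repr.arbitrary k h)]
  have := map_sum (hf.mk' f) (fun i => Coalgebra.counit (R := k) ((Coalgebra.Repr.arbitrary k h).left i) • (Coalgebra.Repr.arbitrary k h).right i) (Coalgebra.Repr.arbitrary k h).index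
  simp only [IsLinearMap.mk'_apply] at this
  rw [this]
  simp [sw, hf.map_smul]

lemma sw_counit_r {f : H → M} (hf : IsLinearMap k f) (h : H) :
    sw k h (fun a b => Coalgebra.counit (R := k) b • f a) = f h := by
  have := congrArg (TensorProduct.lift (((LinearMap.lsmul k M).flip) ∘ₗ hf.mk' f))
    (Coalgebra.sum_tmul_counit_eq (Coalgebra.Repr.arbitrary k h))
  simp only [map_sum, TensorProduct.lift.tmul] at this
  simpa [sw] using this

/-- antipode-like pairings -/
structure Anti (c : H → H → H) : Prop where
  bil : Bil k c
  eq : ∀ x, sw k x c = Coalgebra.counit (R := k) x • (1 : H)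

lemma anti_r : Anti (k := k) (fun a b : H => a * antipode k b) where
  bil := ⟨fun b => ⟨by simp [add_mul], by simp⟩, fun b => ⟨by simp [mul_add], by simp⟩⟩
  eq x := sum_mul_antipode_eq_smul _

lemma anti_l : Anti (k := k) (fun a b : H => antipode k a * b) where
  bil := ⟨fun b => ⟨by simp [add_mul], by simp⟩, fun b => ⟨by simp [mul_add], by simp⟩⟩
  eq x := sum_antipode_mul_eq_smul _

lemma lin_comp {f : H → M} {g : H → H} (hf : IsLinearMap k f) (hg : IsLinearMap k g) :
    IsLinearMap k (fun x => f (g x)) :=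
  ⟨fun x y => by simp [hg.map_add, hf.map_add], fun r x => by simp [hg.map_smul, hf.map_smul]⟩

lemma lin_sw_arg {f : H → M} (hf : IsLinearMap k f) (h : H) (g : H → H → H) :
    sw k h (fun a b => f (g a b)) = f (sw k h g) := by
  exact (map_sw (hf.mk' f) h g).symm

lemma A2 {c : H → H → H} (hc : Anti (k := k) c) {f : H → H → M} (hf : Bil k f) (x : H) :
    sw k x (fun a b => sw k a (fun a1 a2 => f a1 (c a2 b))) = f x 1 := by
  rw [sw_coassoc (f := fun a1 a2 b => f a1 (c a2 b))
    ⟨fun b d => hf.l _, fun a d => lin_comp (hf.r _) (hc.bil.l _),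
     fun a b => lin_comp (hf.r _) (hc.bil.r _)⟩]
  simp only [lin_sw_arg (hf.r _), hc.eq, (hf.r _).map_smul]
  exact sw_counit_r (hf.l 1) x

lemma A1 {c : H → H → H} (hc : Anti (k := k) c) {f : H → H → H → M} (hf : Tri k f) (x : H) :
    sw k x (fun a b => sw k a (fun a1 a2 => sw k b (fun b1 b2 => f a1 (c a2 b1) b2))) =
      sw k x (fun a b => f a 1 b) := by
  have hB (a p : H) : Bil k (fun b1 b2 => f a (c p b1) b2) :=
    ⟨fun d => lin_comp (hf.m _ _) (hc.bil.r _), fun d => hf.r _ _⟩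
  rw [sw_coassoc (f := fun a1 a2 b => sw k b (fun b1 b2 => f a1 (c a2 b1) b2))
    ⟨fun b d => lin_sw2 fun _ _ => hf.l _ _,
     fun b d => lin_sw2 fun _ _ => lin_comp (hf.m _ _) (hc.bil.l _),
     fun a b => lin_sw1 (hB _ _)⟩]
  refine sw_congr fun a b => ?_
  rw [← sw_coassoc (f := fun b1 b2 b3 => f a (c b1 b2) b3)
    ⟨fun b d => lin_comp (hf.m _ _) (hc.bil.l _), fun b d => lin_comp (hf.m _ _) (hc.bil.r _),
      fun b d => hf.r _ _⟩]
  simp only [lin_sw_arg (hf.m _ _), hc.eq, (hf.m _ _).map_smul]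
  exact sw_counit_l (hf.r a 1) b

lemma A3 {c : H → H → H} (hc : Anti (k := k) c) {f : H → H → H → H → M}
    (h1 : ∀ b c d, IsLinearMap k (fun a => f a b c d))
    (h2 : ∀ a c d, IsLinearMap k (fun b => f a b c d))
    (h3 : ∀ a b d, IsLinearMap k (fun c => f a b c d))
    (h4 : ∀ a b c, IsLinearMap k (fun d => f a b c d)) (x : H) :
    sw k x (fun a b => sw k a (fun a1 a2 => sw k b (fun b1 b2 => sw k a2 (fun p q =>
      f a1 p (c q b1) b2)))) =
      sw k x (fun a b => sw k a (fun a1 a2 => f a1 a2 1 b)) := by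
  rw [← A1 hc (f := fun a b c => sw k a (fun a1 a2 => f a1 a2 b c))
    ⟨fun b c => lin_sw1 ⟨fun _ => h1 _ _ _, fun _ => h2 _ _ _⟩,
     fun b c => lin_sw2 fun _ _ => h3 _ _ _, fun b c => lin_sw2 fun _ _ => h4 _ _ _⟩]
  refine sw_congr fun a b => ?_
  rw [sw_comm]; conv_rhs => rw [sw_comm]
  refine sw_congr fun b1 b2 => ?_
  exact (sw_coassoc (f := fun a1 p q => f a1 p (c q b1) b2)
    ⟨fun _ _ => h1 _ _ _, fun _ _ => h2 _ _ _, fun _ _ => lin_comp (h3 _ _ _) (hc.bil.l _)⟩ a).symm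

lemma sw_mul {f : H → H → M} (hf : Bil k f) (h x : H) :
    sw k (h * x) f = sw k h (fun a b => sw k x (fun c d => f (a * c) (b * d))) := by
  unfold sw
  rw [← Finset.sum_product']
  refine (sw_eq (h := h * x) hf (a := fun i => _) (b := fun i => _) ?_).symm
  rw [Bialgebra.comul_mul, ← (Coalgebra.Repr.arbitrary k h).eq, ← (Coalgebra.Repr.arbitrary k x).eq,
    Finset.sum_mul_sum, ← Finset.sum_product']
  simp

lemma sw_one {f : H → H → M} (hf : Bil k f) : sw k 1 f = f 1 1 := by
  rw [sw_lift hf]; simp [Bil.lin, Algebra.TensorProduct.one_def]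

open WithConv in
lemma comul_antipode' (h : H) : Coalgebra.comul (R := k) (antipode k h) =
    sw k h (fun a b => antipode k b ⊗ₜ[k] antipode k a) := by
  have hB : Bil k (fun a b : H => antipode k b ⊗ₜ[k] antipode k a) :=
    ⟨fun _ => ⟨by simp [tmul_add], by simp⟩, fun _ => ⟨by simp [add_tmul], by simp [smul_tmul']⟩⟩
  let T : H →ₗ[k] H ⊗[k] H := (lin_sw1 hB).mk' _
  have e1 : toConv (Coalgebra.comul (R := k) ∘ₗ antipode k) * toConv (Coalgebra.comul (R := k) (A := H)) = 1 := by
    ext x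
    rw [Coalgebra.Repr.convMul_apply (Coalgebra.Repr.arbitrary k x)]
    simp [← Bialgebra.comul_mul, ← map_sum, sum_antipode_mul_eq_smul, Algebra.algebraMap_eq_smul_one]
  have e2 : toConv (Coalgebra.comul (R := k) (A := H)) * toConv T = 1 := by
    ext x
    rw [Coalgebra.Repr.convMul_apply (Coalgebra.Repr.arbitrary k x)]
    have := A1 (k := k) anti_r (f := fun a b c : H => (a * antipode k c) ⊗ₜ[k] b)
      ⟨fun _ _ => ⟨by simp [add_mul, add_tmul], by simp [smul_tmul']⟩,
       fun _ _ => ⟨by simp [tmul_add], by simp⟩,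
       fun _ _ => ⟨by simp [mul_add, add_tmul], by simp [smul_tmul']⟩⟩ x
    have h2 : sw k x (fun a b : H => (a * antipode k b) ⊗ₜ[k] (1:H)) = Coalgebra.counit (R := k) x • 1 := by
      have := congrArg (fun t : H => t ⊗ₜ[k] (1 : H)) (anti_r.eq (k := k) x)
      simpa [sw, sum_tmul, Algebra.TensorProduct.one_def, smul_tmul'] using this
    rw [h2] at this
    rw [LinearMap.convOne_apply, Algebra.algebraMap_eq_smul_one, ← this]
    refine Finset.sum_congr rfl fun i _ => ?_
    simp only [T, IsLinearMap.mk'_apply]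
    rw [← (Coalgebra.Repr.arbitrary k ((Coalgebra.Repr.arbitrary k x).left i)).eq]
    simp [sw, Finset.sum_mul_sum]
  have := congrArg (fun t => t.ofConv h) (left_inv_eq_right_inv e1 e2)
  simpa [T] using this

lemma sw_antipode {f : H → H → M} (hf : Bil k f) (h : H) :
    sw k (antipode k h) f = sw k h (fun a b => f (antipode k b) (antipode k a)) := by
  rw [sw_lift hf, comul_antipode', map_sw]
  simp [Bil.lin]

end swlemmas

section smash
attribute [local simp] add_mul mul_add tmul_add add_tmul smul_tmul'

lemma smash_tmul (act : H →ₗ[k] Module.End k A) (a b : A) (h x : H) :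
    smashMul act (a ⊗ₜ[k] h) (b ⊗ₜ[k] x) =
      sw k h (fun h1 h2 => (a * act h1 b) ⊗ₜ[k] (h2 * x)) := by
  unfold smashMul smashHalf sw
  simp only [TensorProduct.curry_apply, LinearMap.comp_apply, LinearEquiv.coe_coe,
    TensorProduct.assoc_tmul, TensorProduct.map_tmul, TensorProduct.assoc_symm_tmul]
  rw [← (Coalgebra.Repr.arbitrary k h).eq]
  simp [sum_tmul, tmul_sum, -smul_tmul']

lemma sharp_eq (act : H →ₗ[k] Module.End k A) (h : H) :
    sharp act 1 h = sw k h (fun h1 h2 => (act h1 1) ⊗ₜ[k] h2) := by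
  simp [sharp, smash_tmul]

lemma exists_fin (h : H) : ∃ (n : ℕ) (h1 h2 : Fin n → H),
    Coalgebra.comul (R := k) h = ∑ i, h1 i ⊗ₜ[k] h2 i := by
  let e := (Coalgebra.Repr.arbitrary k h).index.equivFin.symm
  refine ⟨_, fun i => (Coalgebra.Repr.arbitrary k h).left (e i),
    fun i => (Coalgebra.Repr.arbitrary k h).right (e i), ?_⟩
  rw [← (Coalgebra.Repr.arbitrary k h).eq, ← Finset.sum_coe_sort]
  exact (Equiv.sum_comp e (fun i => (Coalgebra.Repr.arbitrary k h).left i.1 ⊗ₜ[k]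
    (Coalgebra.Repr.arbitrary k h).right i.1)).symm

lemma smul_swL (act : H →ₗ[k] Module.End k A) (h : H) (f : H → H → A ⊗[k] H) (t : A ⊗[k] H) :
    smashMul act (sw k h f) t = sw k h (fun a b => smashMul act (f a b) t) :=
  map_sw ((smashMul act).flip t) h f

lemma act_sw (act : H →ₗ[k] Module.End k A) (h x : H) (f : H → H → A) :
    act x (sw k h f) = sw k h (fun a b => act x (f a b)) :=
  map_sw (act x) h f

lemma tmul_sw (h : H) (f : H → H → A) (x : H) :
    (sw k h f) ⊗ₜ[k] x = sw k h (fun a b => f a b ⊗ₜ[k] x) :=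
  map_sw ((TensorProduct.mk k A H).flip x) h f

lemma mul_sw (h : H) (f : H → H → A) (x : A) :
    x * (sw k h f) = sw k h (fun a b => x * f a b) :=
  map_sw (LinearMap.mulLeft k x) h f

structure PA (act : H →ₗ[k] Module.End k A) : Prop where
  p1 : ∀ a : A, act 1 a = a
  p2 : ∀ (h : H) (a b : A), act h (a * b) = sw k h (fun h1 h2 => act h1 a * act h2 b)
  p3 : ∀ (h x : H) (a : A), act h (act x a) = sw k h (fun h1 h2 => act h1 1 * act (h2 * x) a)
  p4 : ∀ (h x : H) (a : A), act h (act x a) = sw k h (fun h1 h2 => act (h1 * x) a * act h2 1)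

variable {act : H →ₗ[k] Module.End k A} (P : PA act)
include P

lemma PA.K (y x : H) (b : A) : smashMul act (sharp act 1 y) (b ⊗ₜ[k] x) =
    sw k y (fun y1 y2 => act y1 b ⊗ₜ[k] (y2 * x)) := by
  rw [sharp_eq, smul_swL]
  simp only [smash_tmul]
  rw [← sw_coassoc (f := fun y1 y2 y3 => (act y1 1 * act y2 b) ⊗ₜ[k] (y3 * x))
    ⟨fun _ _ => ⟨by simp, by simp⟩, fun _ _ => ⟨by simp, by simp⟩, fun _ _ => ⟨by simp, by simp⟩⟩]
  refine sw_congr fun a c => ?_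
  rw [← tmul_sw, ← P.p2, one_mul]

lemma PA.Q (y z : H) : smashMul act (sharp act 1 y) (sharp act 1 z) =
    sw k z (fun z1 z2 => sw k y (fun y1 y2 => act y1 (act z1 1) ⊗ₜ[k] (y2 * z2))) := by
  rw [sharp_eq act z, map_sw]
  simp only [P.K]

lemma PA.L1 (h x : H) :
    sw k x (fun x1 x2 => smashMul act (sharp act 1 (h * x1)) (sharp act 1 (antipode k x2))) =
    sw k h (fun h1 h2 => act h1 (act x 1) ⊗ₜ[k] h2) := by
  have e1 : ∀ a b : H, smashMul act (sharp act 1 (h * a)) (sharp act 1 (antipode k b)) =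
      sw k h (fun h1 h2 => sw k a (fun a1 a2 => sw k b (fun b1 b2 =>
        act (h1 * a1) (act (antipode k b2) 1) ⊗ₜ[k] (h2 * (a2 * antipode k b1))))) := by
    intro a b
    rw [P.Q, sw_antipode ⟨fun _ => lin_sw2 fun _ _ => ⟨by simp, by simp⟩,
      fun _ => lin_sw2 fun _ _ => ⟨by simp, by simp⟩⟩]
    conv_rhs => enter [3, h1, h2]; rw [sw_comm]
    conv_rhs => rw [sw_comm]
    refine sw_congr fun b1 b2 => ?_
    rw [sw_mul ⟨fun _ => ⟨by simp, by simp⟩, fun _ => ⟨by simp, by simp⟩⟩]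
    simp only [mul_assoc]
  simp only [e1]
  rw [sw_comm]
  refine sw_congr fun h1 h2 => ?_
  rw [A1 anti_r (f := fun a b c => act (h1 * a) (act (antipode k c) 1) ⊗ₜ[k] (h2 * b))
    ⟨fun _ _ => ⟨by simp, by simp⟩, fun _ _ => ⟨by simp, by simp⟩, fun _ _ => ⟨by simp, by simp⟩⟩]
  rw [← tmul_sw, mul_one]
  congr 1
  have e2 : ∀ a b : H, act (h1 * a) (act (antipode k b) 1) =
      sw k h1 (fun p q => sw k a (fun a1 a2 => act (p * a1) 1 * act (q * (a2 * antipode k b)) 1)) := by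
    intro a b
    rw [P.p3, sw_mul ⟨fun _ => ⟨by simp, by simp⟩, fun _ => ⟨by simp, by simp⟩⟩]
    simp only [mul_assoc]
  simp only [e2]
  rw [sw_comm, P.p4]
  refine sw_congr fun p q => ?_
  rw [A2 anti_r (f := fun a b => act (p * a) 1 * act (q * b) 1)
    ⟨fun _ => ⟨by simp, by simp⟩, fun _ => ⟨by simp, by simp⟩⟩, mul_one]

lemma PA.L1' (x : H) :
    sw k x (fun x1 x2 => smashMul act (sharp act 1 x1) (sharp act 1 (antipode k x2))) =
    act x 1 ⊗ₜ[k] 1 := by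
  have := P.L1 1 x
  rw [sw_one ⟨fun _ => ⟨by simp, by simp⟩, fun _ => ⟨by simp, by simp⟩⟩] at this
  simpa [P.p1] using this

lemma PA.L2 (h x : H) :
    sw k h (fun h1 h2 => smashMul act (sharp act 1 h1) (sharp act 1 (antipode k h2 * x))) =
    sw k x (fun x1 x2 => (act h 1 * act x1 1) ⊗ₜ[k] x2) := by
  have e1 : ∀ a b : H, smashMul act (sharp act 1 a) (sharp act 1 (antipode k b * x)) =
      sw k x (fun x1 x2 => sw k a (fun a1 a2 => sw k b (fun b1 b2 =>
        act a1 (act (antipode k b2 * x1) 1) ⊗ₜ[k] ((a2 * antipode k b1) * x2)))) := by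
    intro a b
    rw [P.Q, sw_mul ⟨fun _ => lin_sw2 fun _ _ => ⟨by simp, by simp⟩,
      fun _ => lin_sw2 fun _ _ => ⟨by simp, by simp⟩⟩,
      sw_antipode ⟨fun _ => lin_sw2 fun _ _ => lin_sw2 fun _ _ => ⟨by simp, by simp⟩,
      fun _ => lin_sw2 fun _ _ => lin_sw2 fun _ _ => ⟨by simp, by simp⟩⟩, sw_comm]
    refine sw_congr fun x1 x2 => ?_
    rw [sw_comm]
    simp only [mul_assoc]
  simp only [e1]
  rw [sw_comm]
  refine sw_congr fun x1 x2 => ?_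
  rw [A1 anti_r (f := fun a b c => act a (act (antipode k c * x1) 1) ⊗ₜ[k] (b * x2))
    ⟨fun _ _ => ⟨by simp, by simp⟩, fun _ _ => ⟨by simp, by simp⟩, fun _ _ => ⟨by simp, by simp⟩⟩]
  rw [← tmul_sw, one_mul]
  congr 1
  simp only [P.p3, ← mul_assoc]
  rw [A2 anti_r (f := fun a b => act a 1 * act (b * x1) 1)
    ⟨fun _ => ⟨by simp, by simp⟩, fun _ => ⟨by simp, by simp⟩⟩, one_mul]

lemma PA.L3 (h x : H) :
    sw k x (fun x1 x2 => smashMul act (sharp act 1 (h * antipode k x1)) (sharp act 1 x2)) =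
    sw k h (fun h1 h2 => sw k x (fun x1 x2 => sw k x1 (fun p q =>
      act h1 (act (antipode k q) 1) ⊗ₜ[k] (h2 * (antipode k p * x2))))) := by
  have e1 : ∀ a b : H, smashMul act (sharp act 1 (h * antipode k a)) (sharp act 1 b) =
      sw k h (fun h1 h2 => sw k a (fun a1 a2 => sw k b (fun b1 b2 =>
        act (h1 * antipode k a2) (act b1 1) ⊗ₜ[k] (h2 * (antipode k a1 * b2))))) := by
    intro a b
    rw [P.Q]
    conv_rhs => enter [3, h1, h2]; rw [sw_comm]
    conv_rhs => rw [sw_comm]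
    refine sw_congr fun b1 b2 => ?_
    rw [sw_mul ⟨fun _ => ⟨by simp, by simp⟩, fun _ => ⟨by simp, by simp⟩⟩]
    refine sw_congr fun h1 h2 => ?_
    rw [sw_antipode ⟨fun _ => ⟨by simp, by simp⟩, fun _ => ⟨by simp, by simp⟩⟩]
    simp only [mul_assoc]
  simp only [e1]
  rw [sw_comm]
  refine sw_congr fun h1 h2 => ?_
  have e2 : ∀ a b : H, act (h1 * antipode k a) (act b 1) =
      sw k h1 (fun u v => sw k a (fun p q =>
        act (u * (antipode k q * b)) 1 * act (v * antipode k p) 1)) := by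
    intro a b
    rw [P.p4, sw_mul ⟨fun _ => ⟨by simp, by simp⟩, fun _ => ⟨by simp, by simp⟩⟩]
    refine sw_congr fun u v => ?_
    rw [sw_antipode ⟨fun _ => ⟨by simp, by simp⟩, fun _ => ⟨by simp, by simp⟩⟩]
    simp only [mul_assoc]
  have e3 : ∀ a b1 b2 p: H, act (h1 * antipode k a) (act b1 1) ⊗ₜ[k] (h2 * (antipode k p * b2)) =
      sw k a (fun a1 a2 => sw k h1 (fun u v => (act (u * (antipode k a2 * b1)) 1
        * act (v * antipode k a1) 1) ⊗ₜ[k] (h2 * (antipode k p * b2)))) := by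
    intro a b1 b2 p
    rw [e2, sw_comm]
    simp only [tmul_sw]
  simp only [e3]
  rw [A3 anti_l (f := fun a b c d => sw k h1 (fun u v => (act (u * c) 1
        * act (v * antipode k b) 1) ⊗ₜ[k] (h2 * (antipode k a * d))))
    (fun _ _ _ => lin_sw2 fun _ _ => ⟨by simp, by simp⟩)
    (fun _ _ _ => lin_sw2 fun _ _ => ⟨by simp, by simp⟩)
    (fun _ _ _ => lin_sw2 fun _ _ => ⟨by simp, by simp⟩)
    (fun _ _ _ => lin_sw2 fun _ _ => ⟨by simp, by simp⟩)]
  simp only [mul_one, P.p3, tmul_sw]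

lemma PA.L3' (x : H) :
    sw k x (fun x1 x2 => smashMul act (sharp act 1 (antipode k x1)) (sharp act 1 x2)) =
    sw k x (fun x1 x2 => sw k x1 (fun p q =>
      (act (antipode k q) 1) ⊗ₜ[k] (antipode k p * x2))) := by
  have := P.L3 1 x
  rw [sw_one ⟨fun _ => lin_sw2 fun _ _ => lin_sw2 fun _ _ => ⟨by simp, by simp⟩,
    fun _ => lin_sw2 fun _ _ => lin_sw2 fun _ _ => ⟨by simp, by simp⟩⟩] at this
  simpa [P.p1] using this

lemma PA.act4 (a b : H) (c : A) : act (antipode k a) (act b c) =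
    sw k a (fun p q => act (antipode k q * b) c * act (antipode k p) 1) := by
  rw [P.p4, sw_antipode ⟨fun _ => ⟨by simp, by simp⟩, fun _ => ⟨by simp, by simp⟩⟩]

lemma PA.act3 (a b : H) (c : A) : act (antipode k a) (act b c) =
    sw k a (fun p q => act (antipode k q) 1 * act (antipode k p * b) c) := by
  rw [P.p3, sw_antipode ⟨fun _ => ⟨by simp, by simp⟩, fun _ => ⟨by simp, by simp⟩⟩]

lemma PA.L5 (h x : H) (c : A) :
    sw k h (fun a b => sw k a (fun a1 a2 => sw k b (fun b1 b2 =>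
      act (antipode k a2) (act b1 c) ⊗ₜ[k] (antipode k a1 * b2 * x)))) =
    sw k h (fun a b => sw k a (fun a1 a2 =>
      (c * act (antipode k a2) 1) ⊗ₜ[k] (antipode k a1 * b * x))) := by
  simp only [P.act4, tmul_sw]
  rw [A3 anti_l (f := fun a1 p u b2 =>
    (act u c * act (antipode k p) 1) ⊗ₜ[k] (antipode k a1 * b2 * x))
    (fun _ _ _ => ⟨by simp, by simp⟩) (fun _ _ _ => ⟨by simp, by simp⟩)
    (fun _ _ _ => ⟨by simp, by simp⟩) (fun _ _ _ => ⟨by simp, by simp⟩)]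
  simp only [P.p1]

lemma PA.L5r (h x : H) :
    sw k h (fun h1 h2 => smashMul act (sharp act 1 (antipode k h1)) (sharp act 1 (h2 * x))) =
    sw k x (fun x1 x2 => sw k h (fun a b => sw k a (fun a1 a2 =>
      (act x1 1 * act (antipode k a2) 1) ⊗ₜ[k] (antipode k a1 * b * x2)))) := by
  have e1 : ∀ a b : H, smashMul act (sharp act 1 (antipode k a)) (sharp act 1 (b * x)) =
      sw k x (fun x1 x2 => sw k a (fun a1 a2 => sw k b (fun b1 b2 =>
        act (antipode k a2) (act (b1 * x1) 1) ⊗ₜ[k] (antipode k a1 * b2 * x2)))) := by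
    intro a b
    rw [P.Q, sw_mul ⟨fun _ => lin_sw2 fun _ _ => ⟨by simp, by simp⟩,
      fun _ => lin_sw2 fun _ _ => ⟨by simp, by simp⟩⟩, sw_comm]
    refine sw_congr fun x1 x2 => ?_
    rw [sw_comm, sw_antipode ⟨fun _ => lin_sw2 fun _ _ => ⟨by simp, by simp⟩,
      fun _ => lin_sw2 fun _ _ => ⟨by simp, by simp⟩⟩]
    simp only [mul_assoc]
  simp only [e1]
  rw [sw_comm]
  refine sw_congr fun x1 x2 => ?_
  simp only [P.act4, tmul_sw, ← mul_assoc]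
  rw [A3 anti_l (f := fun a1 p u b2 =>
    (act (u * x1) 1 * act (antipode k p) 1) ⊗ₜ[k] (antipode k a1 * b2 * x2))
    (fun _ _ _ => ⟨by simp, by simp⟩) (fun _ _ _ => ⟨by simp, by simp⟩)
    (fun _ _ _ => ⟨by simp, by simp⟩) (fun _ _ _ => ⟨by simp, by simp⟩)]
  simp only [one_mul]

lemma PA.L5l (h x : H) :
    smashMul act (sw k h (fun x1 x2 => sw k x1 (fun p q =>
      (act (antipode k q) 1) ⊗ₜ[k] (antipode k p * x2)))) (sharp act 1 x) =
    sw k x (fun x1 x2 => sw k h (fun a b => sw k a (fun a1 a2 =>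
      (act x1 1 * act (antipode k a2) 1) ⊗ₜ[k] (antipode k a1 * b * x2)))) := by
  rw [sharp_eq, map_sw]
  refine sw_congr fun x1 x2 => ?_
  rw [← P.L5]
  simp only [smul_swL, smash_tmul]
  refine sw_congr fun a b => ?_
  have e1 : ∀ p q : H, sw k (antipode k p * b) (fun h1 h2 =>
      (act (antipode k q) 1 * act h1 (act x1 1)) ⊗ₜ[k] (h2 * x2)) =
      sw k b (fun b1 b2 => sw k p (fun p1 p2 =>
      (act (antipode k q) 1 * act (antipode k p2 * b1) (act x1 1)) ⊗ₜ[k] (antipode k p1 * b2 * x2))) := by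
    intro p q
    rw [sw_mul ⟨fun _ => ⟨by simp, by simp⟩, fun _ => ⟨by simp, by simp⟩⟩, sw_comm]
    refine sw_congr fun b1 b2 => ?_
    rw [sw_antipode ⟨fun _ => ⟨by simp, by simp⟩, fun _ => ⟨by simp, by simp⟩⟩]
  simp only [e1]
  rw [sw_comm]
  conv_rhs => rw [sw_comm]
  refine sw_congr fun b1 b2 => ?_
  rw [sw_coassoc (f := fun p1 p2 q =>
    (act (antipode k q) 1 * act (antipode k p2 * b1) (act x1 1)) ⊗ₜ[k] (antipode k p1 * b2 * x2))
    ⟨fun _ _ => ⟨by simp, by simp⟩, fun _ _ => ⟨by simp, by simp⟩, fun _ _ => ⟨by simp, by simp⟩⟩]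
  simp only [P.act3, tmul_sw]

end smash

/-- For a symmetric partial action of `H` on `A`, the map
`π₀ : H → A#H`, `π₀(h) = 1_A # h`, is a partial representation of `H`
(the axioms (PR1)-(PR5) hold in the partial smash product, whose multiplication is
`smashMul act` and whose unit is `1_A # 1_H`). -/
theorem smash_pi0_is_partialRep (act : H →ₗ[k] Module.End k A)
    -- (PA1)
    (hPA1 : ∀ a : A, act 1 a = a)
    -- (PA2)
    (hPA2 : ∀ (h : H) (a b : A) (n : ℕ) (h1 h2 : Fin n → H),
      Coalgebra.comul (R := k) h = ∑ i, h1 i ⊗ₜ[k] h2 i →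
      act h (a * b) = ∑ i, act (h1 i) a * act (h2 i) b)
    -- (PA3)
    (hPA3 : ∀ (h x : H) (a : A) (n : ℕ) (h1 h2 : Fin n → H),
      Coalgebra.comul (R := k) h = ∑ i, h1 i ⊗ₜ[k] h2 i →
      act h (act x a) = ∑ i, act (h1 i) 1 * act (h2 i * x) a)
    -- (PA4)
    (hPA4 : ∀ (h x : H) (a : A) (n : ℕ) (h1 h2 : Fin n → H),
      Coalgebra.comul (R := k) h = ∑ i, h1 i ⊗ₜ[k] h2 i →
      act h (act x a) = ∑ i, act (h1 i * x) a * act (h2 i) 1) :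
    -- π₀ is a partial representation, where π₀ h = 1_A # h :
    (sharp act 1 (1 : H) = sharp act 1 (1 : H)) ∧
    -- (PR2)
    (∀ (h x : H) (n : ℕ) (x1 x2 : Fin n → H),
      Coalgebra.comul (R := k) x = ∑ i, x1 i ⊗ₜ[k] x2 i →
      smashMul act (sharp act 1 h)
          (∑ i, smashMul act (sharp act 1 (x1 i)) (sharp act 1 (antipode (R := k) (x2 i)))) =
        ∑ i, smashMul act (sharp act 1 (h * x1 i)) (sharp act 1 (antipode (R := k) (x2 i)))) ∧
    -- (PR3)
    (∀ (h x : H) (n : ℕ) (h1 h2 : Fin n → H),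
      Coalgebra.comul (R := k) h = ∑ i, h1 i ⊗ₜ[k] h2 i →
      smashMul act
          (∑ i, smashMul act (sharp act 1 (h1 i)) (sharp act 1 (antipode (R := k) (h2 i))))
          (sharp act 1 x) =
        ∑ i, smashMul act (sharp act 1 (h1 i)) (sharp act 1 (antipode (R := k) (h2 i) * x))) ∧
    -- (PR4)
    (∀ (h x : H) (n : ℕ) (x1 x2 : Fin n → H),
      Coalgebra.comul (R := k) x = ∑ i, x1 i ⊗ₜ[k] x2 i →
      smashMul act (sharp act 1 h)
          (∑ i, smashMul act (sharp act 1 (antipode (R := k) (x1 i))) (sharp act 1 (x2 i))) =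
        ∑ i, smashMul act (sharp act 1 (h * antipode (R := k) (x1 i))) (sharp act 1 (x2 i))) ∧
    -- (PR5)
    (∀ (h x : H) (n : ℕ) (h1 h2 : Fin n → H),
      Coalgebra.comul (R := k) h = ∑ i, h1 i ⊗ₜ[k] h2 i →
      smashMul act
          (∑ i, smashMul act (sharp act 1 (antipode (R := k) (h1 i))) (sharp act 1 (h2 i)))
          (sharp act 1 x) =
        ∑ i, smashMul act (sharp act 1 (antipode (R := k) (h1 i))) (sharp act 1 (h2 i * x))) := by
  have P : PA act := by
    refine ⟨hPA1, fun h a b => ?_, fun h x a => ?_, fun h x a => ?_⟩ <;>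
      obtain ⟨n, h1, h2, e⟩ := exists_fin (k := k) h
    · rw [hPA2 h a b n h1 h2 e]
      exact sw_eq (f := fun h1 h2 => act h1 a * act h2 b)
        ⟨fun _ => ⟨by simp [add_mul], by simp⟩, fun _ => ⟨by simp [mul_add], by simp⟩⟩ e
    · rw [hPA3 h x a n h1 h2 e]
      exact sw_eq (f := fun h1 h2 => act h1 1 * act (h2 * x) a)
        ⟨fun _ => ⟨by simp [add_mul], by simp⟩, fun _ => ⟨by simp [add_mul, mul_add], by simp⟩⟩ e
    · rw [hPA4 h x a n h1 h2 e]
      exact sw_eq (f := fun h1 h2 => act (h1 * x) a * act h2 1)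
        ⟨fun _ => ⟨by simp [add_mul], by simp⟩, fun _ => ⟨by simp [add_mul, mul_add], by simp⟩⟩ e
  have sadd : ∀ a b : H, sharp act 1 (a + b) = sharp act 1 a + sharp act 1 b := by
    intro a b; simp [sharp, tmul_add]
  have ssmul : ∀ (r : k) (a : H), sharp act 1 (r • a) = r • sharp act 1 a := by
    intro r a; simp [sharp]
  have B1 : ∀ h : H, Bil k (fun a b => smashMul act (sharp act 1 (h * a)) (sharp act 1 (antipode k b))) :=
    fun h => ⟨fun _ => ⟨by simp [sadd, mul_add], by simp [ssmul]⟩,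
      fun _ => ⟨by simp [sadd], by simp [ssmul]⟩⟩
  have B2 : ∀ h : H, Bil k (fun a b => smashMul act (sharp act 1 a) (sharp act 1 (antipode k b * h))) :=
    fun h => ⟨fun _ => ⟨by simp [sadd], by simp [ssmul]⟩,
      fun _ => ⟨by simp [sadd, add_mul], by simp [ssmul]⟩⟩
  have B3 : ∀ h : H, Bil k (fun a b => smashMul act (sharp act 1 (h * antipode k a)) (sharp act 1 b)) :=
    fun h => ⟨fun _ => ⟨by simp [sadd, mul_add], by simp [ssmul]⟩,
      fun _ => ⟨by simp [sadd], by simp [ssmul]⟩⟩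
  have B4 : ∀ h : H, Bil k (fun a b => smashMul act (sharp act 1 (antipode k a)) (sharp act 1 (b * h))) :=
    fun h => ⟨fun _ => ⟨by simp [sadd], by simp [ssmul]⟩,
      fun _ => ⟨by simp [sadd, add_mul], by simp [ssmul]⟩⟩
  have B1' := B1 1
  have B3' := B3 1
  simp only [one_mul] at B1' B3'
  refine ⟨rfl, fun h x n x1 x2 e => ?_, fun h x n h1 h2 e => ?_, fun h x n x1 x2 e => ?_,
    fun h x n h1 h2 e => ?_⟩
  · rw [sw_eq B1' e, sw_eq (B1 h) e, P.L1, P.L1', P.K]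
    simp only [mul_one]
  · rw [sw_eq B1' e, sw_eq (B2 x) e, P.L2, P.L1', sharp_eq, map_sw]
    refine sw_congr fun a b => ?_
    rw [smash_tmul, sw_one ⟨fun _ => ⟨by simp [mul_add, add_tmul], by simp [smul_tmul']⟩,
      fun _ => ⟨by simp [add_mul, tmul_add], by simp⟩⟩, P.p1, one_mul]
  · rw [sw_eq B3' e, sw_eq (B3 h) e, P.L3, P.L3']
    conv_rhs => rw [sw_comm]
    rw [map_sw]
    refine sw_congr fun a b => ?_
    rw [map_sw, sw_comm]
    simp only [P.K]
  · rw [sw_eq B3' e, sw_eq (B4 x) e, P.L5r, P.L3', P.L5l]
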